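/- With H(x,y) as the extended Pearcey kernel entry above, the differential operator identity (∂_x³ + ∂_y³ − τ_i ∂_x − τ_j ∂_y + (x − y)) H(x,y) = 0 holds. -/

import Mathlib

open MeasureTheory Complex

open Filter Topology

theorem quartic_le (a b : ℝ) : ∃ C : ℝ, ∀ r : ℝ, -r ^ 4 / 4 + a * r ^ 2 + b * |r| ≤ C - r ^ 2 := by
  refine ⟨(a + |b| + 1) ^ 2 + |b|, fun r => ?_⟩
  have h1 : b * |r| ≤ |b| * (1 + r ^ 2) := by
    have : |r| ≤ 1 + r ^ 2 := by nlinarith [sq_nonneg (|r| - 1), sq_abs r]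
    calc b * |r| ≤ |b| * |r| := by gcongr; exact le_abs_self b
      _ ≤ _ := by gcongr
  nlinarith [sq_nonneg (r ^ 2 / 2 - (a + |b| + 1))]

/-- The quartic phase of the Pearcey kernel. -/
noncomputable def pearceyPhase (τ x : ℝ) (z : ℂ) : ℂ := z ^ 4 / 4 - τ * z ^ 2 / 2 + x * z

/-- The derivative of the Pearcey phase. -/
noncomputable def pearceyPhaseDeriv (τ x : ℝ) (z : ℂ) : ℂ := z ^ 3 - τ * z + x

theorem hasDerivAt_pearceyPhase (τ x : ℝ) (z : ℂ) :
    HasDerivAt (pearceyPhase τ x) (pearceyPhaseDeriv τ x z) z := by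
  unfold pearceyPhase pearceyPhaseDeriv
  refine ((((hasDerivAt_pow 4 z).div_const 4).sub
    (((hasDerivAt_pow 2 z).const_mul (τ : ℂ)).div_const 2)).add
    ((hasDerivAt_id z).const_mul (x : ℂ))).congr_deriv ?_
  push_cast
  ring

@[fun_prop]
theorem continuous_pearceyPhase (τ x : ℝ) : Continuous (pearceyPhase τ x) := by
  unfold pearceyPhase; fun_prop

@[fun_prop]
theorem continuous_pearceyPhaseDeriv (τ x : ℝ) : Continuous (pearceyPhaseDeriv τ x) := by
  unfold pearceyPhaseDeriv; fun_prop

theorem exists_norm_exp_pearceyPhase_le (τ x R : ℝ) :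
    ∃ C : ℝ, 0 < C ∧ ∀ (ε z : ℂ) (r : ℝ), ‖ε‖ = 1 → ‖z‖ = |r| → ε * z ^ 4 = -(r : ℂ) ^ 4 →
      Real.exp (R * |r|) * ‖exp (ε * pearceyPhase τ x z)‖ ≤ C * Real.exp (-r ^ 2) := by
  obtain ⟨C, hC⟩ := quartic_le (|τ| / 2) (|x| + R)
  refine ⟨Real.exp C, Real.exp_pos _, fun ε z r hε hz h4 => ?_⟩
  rw [norm_exp, ← Real.exp_add, ← Real.exp_add]
  refine Real.exp_le_exp.mpr (le_trans ?_ (le_of_le_of_eq (hC r) (by ring)))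
  have h : ε * pearceyPhase τ x z = ((-r ^ 4 / 4 : ℝ) : ℂ) + ε * (-(τ * z ^ 2 / 2) + x * z) := by
    unfold pearceyPhase
    push_cast
    linear_combination h4 / 4
  have h2 : (ε * (-(τ * z ^ 2 / 2) + x * z)).re ≤ |τ| / 2 * r ^ 2 + |x| * |r| := by
    refine (re_le_norm _).trans ?_
    rw [norm_mul, hε, one_mul]
    refine (norm_add_le _ _).trans ?_
    simp only [norm_neg, norm_div, norm_mul, norm_pow, hz, sq_abs, norm_real, Real.norm_eq_abs,
      norm_ofNat]
    linarith
  rw [h, add_re, ofReal_re]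
  linarith

variable {θ : ℂ}

theorem pow_four_eq_neg_one (hre : θ.re ^ 2 = 1 / 2) (him : θ.im ^ 2 = 1 / 2) : θ ^ 4 = -1 := by
  have h : θ = θ.re + θ.im * I := (re_add_im θ).symm
  have h1 : (θ.re : ℂ) ^ 2 = 1 / 2 := by rw [← ofReal_pow, hre]; norm_num
  have h2 : (θ.im : ℂ) ^ 2 = 1 / 2 := by rw [← ofReal_pow, him]; norm_num
  have h3 : θ ^ 2 = 2 * θ.re * θ.im * I := by
    conv_lhs => rw [h]
    linear_combination h1 - h2 + (θ.im : ℂ) ^ 2 * I_sq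
  calc θ ^ 4 = (θ ^ 2) ^ 2 := by ring
    _ = _ := by
      rw [h3]
      linear_combination 4 * (θ.re : ℂ) ^ 2 * (θ.im : ℂ) ^ 2 * I_sq - 4 * (θ.re : ℂ) ^ 2 * h2 -
        2 * h1

theorem norm_eq_one_of_re_im (hre : θ.re ^ 2 = 1 / 2) (him : θ.im ^ 2 = 1 / 2) : ‖θ‖ = 1 := by
  rw [norm_eq_sqrt_sq_add_sq, hre, him]; norm_num

theorem norm_sq_I_mul_sub (hre : θ.re ^ 2 = 1 / 2) (him : θ.im ^ 2 = 1 / 2) (u r : ℝ) :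
    ‖I * (u : ℂ) - r * θ‖ ^ 2 = u ^ 2 - 2 * u * r * θ.im + r ^ 2 := by
  rw [← normSq_eq_norm_sq, normSq_apply]
  simp
  linear_combination r ^ 2 * hre + r ^ 2 * him

theorem sq_add_sq_le_norm_sq (hre : θ.re ^ 2 = 1 / 2) (him : θ.im ^ 2 = 1 / 2) (u r : ℝ) :
    (u ^ 2 + r ^ 2) / 4 ≤ ‖I * (u : ℂ) - r * θ‖ ^ 2 := by
  rw [norm_sq_I_mul_sub hre him]
  have h : |θ.im| ≤ 3 / 4 := abs_le_of_sq_le_sq (by rw [him]; norm_num) (by norm_num)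
  have h' := abs_le.mp h
  nlinarith [sq_nonneg (u - r), sq_nonneg (u + r)]

theorem norm_inv_I_mul_sub_le (hre : θ.re ^ 2 = 1 / 2) (him : θ.im ^ 2 = 1 / 2) {u r : ℝ}
    (hu : u ≠ 0) (hr : r ≠ 0) :
    ‖(I * (u : ℂ) - r * θ)⁻¹‖ ≤ 2 * (|r| ^ (-(1 / 2) : ℝ) * |u| ^ (-(1 / 2) : ℝ)) := by
  have hu' := abs_pos.mpr hu
  have hr' := abs_pos.mpr hr
  rw [norm_inv, Real.rpow_neg hr'.le, Real.rpow_neg hu'.le, ← Real.sqrt_eq_rpow,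
    ← Real.sqrt_eq_rpow,
    ← mul_inv, ← inv_inv (2 : ℝ), ← mul_inv]
  refine inv_anti₀ (by positivity) (abs_le_of_sq_le_sq' ?_ (norm_nonneg _)).2
  refine le_trans ?_ (sq_add_sq_le_norm_sq hre him u r)
  rw [mul_pow, mul_pow, Real.sq_sqrt hr'.le, Real.sq_sqrt hu'.le]
  nlinarith [sq_nonneg (|u| - |r|), sq_abs u, sq_abs r]

theorem integrable_abs_rpow_mul_exp_neg_sq :
    Integrable fun u : ℝ => |u| ^ (-(1 / 2) : ℝ) * Real.exp (-u ^ 2) := by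
  have h := integrableOn_rpow_mul_exp_neg_mul_sq one_pos (s := -(1 / 2)) (by norm_num)
  have h1 : IntegrableOn (fun u : ℝ => |u| ^ (-(1 / 2) : ℝ) * Real.exp (-u ^ 2)) (Set.Ioi 0) :=
    h.congr_fun (fun u hu => by simp [abs_of_pos (Set.mem_Ioi.mp hu)]) measurableSet_Ioi
  have h2 := (integrableOn_Ici_iff_integrableOn_Ioi (by finiteness)).mpr h1
  rw [← neg_zero] at h2
  have h3 := h2.comp_neg_Iic
  simp only [abs_neg, neg_sq] at h3
  rw [← integrableOn_univ, ← Set.Iic_union_Ioi (a := (0 : ℝ))]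
  exact h3.union h1

/-- Integrability of the Pearcey integrand on the product of a ray and the imaginary axis. -/
theorem integrable_mul_pearcey (hre : θ.re ^ 2 = 1 / 2) (him : θ.im ^ 2 = 1 / 2) (τ σ x y : ℝ)
    {g : ℝ × ℝ → ℂ} (hg : Measurable g) {M R : ℝ}
    (hb : ∀ p, ‖g p‖ ≤ M * (Real.exp (R * |p.1|) * Real.exp (R * |p.2|))) :
    Integrable (fun p : ℝ × ℝ => g p *
      (exp (pearceyPhase τ x (p.1 * θ)) * exp (-pearceyPhase σ y (I * p.2)) *
        (I * (p.2 : ℂ) - p.1 * θ)⁻¹)) ((volume.restrict (Set.Ioi 0)).prod volume) := by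
  obtain ⟨C₁, hC₁, h₁⟩ := exists_norm_exp_pearceyPhase_le τ x R
  obtain ⟨C₂, hC₂, h₂⟩ := exists_norm_exp_pearceyPhase_le σ y R
  have hM : 0 ≤ M := by
    have := (norm_nonneg _).trans (hb (0, 0))
    simpa using this
  have hw := (integrable_abs_rpow_mul_exp_neg_sq.restrict (s := Set.Ioi 0)).mul_prod
    integrable_abs_rpow_mul_exp_neg_sq
  refine (hw.const_mul (M * C₁ * C₂ * 2)).mono' (by fun_prop) ?_
  have e1 : ∀ᵐ p : ℝ × ℝ ∂((volume.restrict (Set.Ioi 0)).prod volume), p.1 ≠ 0 :=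
    Measure.quasiMeasurePreserving_fst.ae
      ((ae_restrict_mem measurableSet_Ioi).mono fun r hr => (Set.mem_Ioi.mp hr).ne')
  have e2 : ∀ᵐ p : ℝ × ℝ ∂((volume.restrict (Set.Ioi (0 : ℝ))).prod volume), p.2 ≠ 0 :=
    Measure.quasiMeasurePreserving_snd.ae (Measure.ae_ne volume 0)
  filter_upwards [e1, e2] with p hp1 hp2
  have k1 := h₁ 1 (p.1 * θ) p.1 (by simp) (by simp [norm_eq_one_of_re_im hre him])
    (by rw [mul_pow, pow_four_eq_neg_one hre him]; ring)
  have k2 := h₂ (-1) (I * p.2) p.2 (by simp) (by simp) (by rw [mul_pow, I_pow_four]; ring)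
  have k3 := norm_inv_I_mul_sub_le hre him hp2 hp1
  rw [one_mul] at k1
  rw [neg_one_mul] at k2
  rw [norm_mul, norm_mul, norm_mul]
  calc _ ≤ M * (Real.exp (R * |p.1|) * Real.exp (R * |p.2|)) *
      (‖exp (pearceyPhase τ x (p.1 * θ))‖ * ‖exp (-pearceyPhase σ y (I * p.2))‖ *
        ‖(I * (p.2 : ℂ) - p.1 * θ)⁻¹‖) := by gcongr; exact hb p
    _ = M * ((Real.exp (R * |p.1|) * ‖exp (pearceyPhase τ x (p.1 * θ))‖) *
      (Real.exp (R * |p.2|) * ‖exp (-pearceyPhase σ y (I * p.2))‖) *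
        ‖(I * (p.2 : ℂ) - p.1 * θ)⁻¹‖) := by ring
    _ ≤ M * ((C₁ * Real.exp (-p.1 ^ 2)) * (C₂ * Real.exp (-p.2 ^ 2)) *
        (2 * (|p.1| ^ (-(1 / 2) : ℝ) * |p.2| ^ (-(1 / 2) : ℝ)))) := by gcongr
    _ = _ := by ring

section DerivIntegral

variable {α : Type*} [MeasurableSpace α] {μ : Measure α} {A b : α → ℂ}

theorem hasDerivAt_integral_mul_exp (hA : AEStronglyMeasurable A μ)
    (hb : AEStronglyMeasurable b μ)
    (h : ∀ R, Integrable (fun p => ‖A p * b p‖ * Real.exp (R * ‖b p‖)) μ)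
    (h' : ∀ R, Integrable (fun p => ‖A p‖ * Real.exp (R * ‖b p‖)) μ) (x : ℝ) :
    HasDerivAt (fun x : ℝ => ∫ p, A p * exp (x * b p) ∂μ)
      (∫ p, A p * b p * exp (x * b p) ∂μ) x := by
  have hexp (x : ℝ) (R : ℝ) (hR : |x| ≤ R) (z : ℂ) : ‖exp (x * z)‖ ≤ Real.exp (R * ‖z‖) := by
    refine (norm_exp_le_exp_norm _).trans (Real.exp_le_exp.mpr ?_)
    rw [norm_mul, norm_real, Real.norm_eq_abs]
    gcongr
  have hm (x : ℝ) : AEStronglyMeasurable (fun p => exp (x * b p)) μ :=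
    continuous_exp.comp_aestronglyMeasurable (hb.const_mul _)
  refine (hasDerivAt_integral_of_dominated_loc_of_deriv_le (s := Metric.ball x 1)
    (F' := fun x p => A p * b p * exp (x * b p))
    (bound := fun p => ‖A p * b p‖ * Real.exp ((|x| + 1) * ‖b p‖)) (Metric.ball_mem_nhds _ one_pos)
    (.of_forall fun x => hA.mul (hm x)) ?_ ((hA.mul hb).mul (hm x)) ?_ (h _) ?_).2
  · refine (h' |x|).mono' (hA.mul (hm x)) (.of_forall fun p => ?_)
    rw [Pi.mul_apply, norm_mul]
    gcongr
    exact hexp x _ le_rfl _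
  · refine .of_forall fun p z hz => ?_
    rw [norm_mul]
    gcongr
    refine hexp z _ ?_ _
    rw [Metric.mem_ball, Real.dist_eq] at hz
    linarith [abs_sub_abs_le_abs_sub z x]
  · refine .of_forall fun p z _ => ?_
    have := ((ofRealCLM.hasDerivAt (x := z)).mul_const (b p)).cexp.const_mul (A p)
    refine this.congr_deriv ?_
    simp
    ring

end DerivIntegral

theorem iteratedDeriv_eq_of_hasDerivAt {g : ℕ → ℝ → ℂ} (h : ∀ n x, HasDerivAt (g n) (g (n + 1) x) x)
    (n : ℕ) : iteratedDeriv n (g 0) = g n := by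
  induction n with
  | zero => simp
  | succ n ih => rw [iteratedDeriv_succ, ih]; exact funext fun x => (h n x).deriv

theorem pow_le_factorial_mul_exp {a : ℝ} (ha : 0 ≤ a) (n : ℕ) :
    a ^ n ≤ n.factorial * Real.exp a := by
  have := Real.pow_div_factorial_le_exp a ha n
  rwa [div_le_iff₀' (by positivity)] at this

/-- The double integral over a ray and the imaginary axis of the Pearcey integrand, weighted by
`t ^ n * (-s) ^ m`. -/
noncomputable def pearceyMoment (θ : ℂ) (τ σ : ℝ) (n m : ℕ) (x y : ℝ) : ℂ :=
  ∫ p : ℝ × ℝ, (p.1 * θ) ^ n * (-(I * p.2)) ^ m *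
      (exp (pearceyPhase τ x (p.1 * θ)) * exp (-pearceyPhase σ y (I * p.2)) *
        (I * (p.2 : ℂ) - p.1 * θ)⁻¹) ∂((volume.restrict (Set.Ioi 0)).prod volume)

theorem integrable_pearceyMoment_mul_exp (hre : θ.re ^ 2 = 1 / 2) (him : θ.im ^ 2 = 1 / 2)
    (τ σ : ℝ) (n m : ℕ) (x y R₁ R₂ : ℝ) :
    Integrable (fun p : ℝ × ℝ => (p.1 * θ) ^ n * (-(I * p.2)) ^ m *
      (Real.exp (R₁ * |p.1|) * Real.exp (R₂ * |p.2|) : ℝ) *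
      (exp (pearceyPhase τ x (p.1 * θ)) * exp (-pearceyPhase σ y (I * p.2)) *
        (I * (p.2 : ℂ) - p.1 * θ)⁻¹)) ((volume.restrict (Set.Ioi 0)).prod volume) := by
  refine integrable_mul_pearcey hre him τ σ x y (M := n.factorial * m.factorial)
    (R := 1 + |R₁| + |R₂|) (by fun_prop) fun p => ?_
  simp only [norm_mul, norm_pow, norm_neg, norm_eq_one_of_re_im hre him, norm_I, norm_real,
    Real.norm_eq_abs, mul_one, one_mul, Real.abs_exp, ofReal_mul]
  have h1 (k : ℕ) (r R : ℝ) (hR : R ≤ |R₁| + |R₂|) :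
      |r| ^ k * Real.exp (R * |r|) ≤ k.factorial * Real.exp ((1 + |R₁| + |R₂|) * |r|) := by
    calc _ ≤ k.factorial * Real.exp |r| * Real.exp ((|R₁| + |R₂|) * |r|) := by
          gcongr
          exact pow_le_factorial_mul_exp (abs_nonneg r) k
      _ = _ := by
          rw [mul_assoc, ← Real.exp_add]
          ring_nf
  calc _ = (|p.1| ^ n * Real.exp (R₁ * |p.1|)) * (|p.2| ^ m * Real.exp (R₂ * |p.2|)) := by ring
    _ ≤ (n.factorial * Real.exp ((1 + |R₁| + |R₂|) * |p.1|)) *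
        (m.factorial * Real.exp ((1 + |R₁| + |R₂|) * |p.2|)) :=
      mul_le_mul (h1 n _ _ (by linarith [le_abs_self R₁, abs_nonneg R₂]))
        (h1 m _ _ (by linarith [le_abs_self R₂, abs_nonneg R₁])) (by positivity) (by positivity)
    _ = _ := by ring

theorem integrable_pearceyMoment (hre : θ.re ^ 2 = 1 / 2) (him : θ.im ^ 2 = 1 / 2)
    (τ σ : ℝ) (n m : ℕ) (x y : ℝ) :
    Integrable (fun p : ℝ × ℝ => (p.1 * θ) ^ n * (-(I * p.2)) ^ m *
      (exp (pearceyPhase τ x (p.1 * θ)) * exp (-pearceyPhase σ y (I * p.2)) *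
        (I * (p.2 : ℂ) - p.1 * θ)⁻¹)) ((volume.restrict (Set.Ioi 0)).prod volume) := by
  simpa using integrable_pearceyMoment_mul_exp hre him τ σ n m x y 0 0

theorem hasDerivAt_pearceyMoment_left (hre : θ.re ^ 2 = 1 / 2) (him : θ.im ^ 2 = 1 / 2)
    (τ σ : ℝ) (n m : ℕ) (x y : ℝ) :
    HasDerivAt (fun x => pearceyMoment θ τ σ n m x y) (pearceyMoment θ τ σ (n + 1) m x y) x := by
  have key := hasDerivAt_integral_mul_exp (μ := (volume.restrict (Set.Ioi 0)).prod volume)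
    (A := fun p : ℝ × ℝ => (p.1 * θ) ^ n * (-(I * p.2)) ^ m *
      (exp (pearceyPhase τ 0 (p.1 * θ)) * exp (-pearceyPhase σ y (I * p.2)) *
        (I * (p.2 : ℂ) - p.1 * θ)⁻¹)) (b := fun p => p.1 * θ) (by fun_prop) (by fun_prop)
    (fun R => by
      refine (integrable_pearceyMoment_mul_exp hre him τ σ (n + 1) m 0 y R 0).norm.congr
        (.of_forall fun p => ?_)
      simp [-ofReal_exp, -ofReal_mul, norm_eq_one_of_re_im hre him]
      ring)
    (fun R => by
      refine (integrable_pearceyMoment_mul_exp hre him τ σ n m 0 y R 0).norm.congr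
        (.of_forall fun p => ?_)
      simp [-ofReal_exp, -ofReal_mul, norm_eq_one_of_re_im hre him]
      ring) x
  have hx (x : ℝ) (z : ℂ) : exp (pearceyPhase τ x z) = exp (pearceyPhase τ 0 z) * exp (x * z) := by
    rw [← exp_add]
    simp [pearceyPhase]
  convert key using 1
  · refine funext fun x => integral_congr_ae (.of_forall fun p => ?_)
    simp only [hx x]
    ring
  · refine integral_congr_ae (.of_forall fun p => ?_)
    simp only [hx x]
    ring

theorem hasDerivAt_pearceyMoment_right (hre : θ.re ^ 2 = 1 / 2) (him : θ.im ^ 2 = 1 / 2)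
    (τ σ : ℝ) (n m : ℕ) (x y : ℝ) :
    HasDerivAt (fun y => pearceyMoment θ τ σ n m x y) (pearceyMoment θ τ σ n (m + 1) x y) y := by
  have key := hasDerivAt_integral_mul_exp (μ := (volume.restrict (Set.Ioi 0)).prod volume)
    (A := fun p : ℝ × ℝ => (p.1 * θ) ^ n * (-(I * p.2)) ^ m *
      (exp (pearceyPhase τ x (p.1 * θ)) * exp (-pearceyPhase σ 0 (I * p.2)) *
        (I * (p.2 : ℂ) - p.1 * θ)⁻¹)) (b := fun p => -(I * p.2)) (by fun_prop) (by fun_prop)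
    (fun R => by
      refine (integrable_pearceyMoment_mul_exp hre him τ σ n (m + 1) x 0 0 R).norm.congr
        (.of_forall fun p => ?_)
      simp [-ofReal_exp, -ofReal_mul, norm_eq_one_of_re_im hre him]
      ring)
    (fun R => by
      refine (integrable_pearceyMoment_mul_exp hre him τ σ n m x 0 0 R).norm.congr
        (.of_forall fun p => ?_)
      simp [-ofReal_exp, -ofReal_mul, norm_eq_one_of_re_im hre him]
      ring) y
  have hy (y : ℝ) (z : ℂ) :
      exp (-pearceyPhase σ y z) = exp (-pearceyPhase σ 0 z) * exp (y * -z) := by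
    rw [← exp_add]
    simp [pearceyPhase]
    ring_nf
  convert key using 1
  · refine funext fun y => integral_congr_ae (.of_forall fun p => ?_)
    simp only [hy y]
    ring
  · refine integral_congr_ae (.of_forall fun p => ?_)
    simp only [hy y]
    ring

/-- The Cauchy transform over the imaginary axis of the `s`-dependent factor. -/
noncomputable def pearceyCauchy (σ y : ℝ) (t : ℂ) : ℂ :=
  ∫ u : ℝ, exp (-pearceyPhase σ y (I * u)) * (I * (u : ℂ) - t)⁻¹

theorem integrable_mul_exp_neg_pearceyPhase (σ y : ℝ) {g : ℝ → ℂ} (hg : Measurable g) {M R : ℝ}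
    (hb : ∀ u, ‖g u‖ ≤ M * Real.exp (R * |u|)) :
    Integrable fun u : ℝ => g u * exp (-pearceyPhase σ y (I * u)) := by
  obtain ⟨C, hC, h⟩ := exists_norm_exp_pearceyPhase_le σ y R
  have hM : 0 ≤ M := by
    have := (norm_nonneg _).trans (hb 0)
    simpa using this
  have hfi : Integrable fun u : ℝ => Real.exp (-u ^ 2) := by
    simpa using integrable_exp_neg_mul_sq one_pos
  refine (hfi.const_mul (M * C)).mono' (by fun_prop) (.of_forall fun u => ?_)
  have k := h (-1) (I * u) u (by simp) (by simp) (by rw [mul_pow, I_pow_four]; ring)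
  rw [neg_one_mul] at k
  rw [norm_mul]
  calc _ ≤ M * Real.exp (R * |u|) * ‖exp (-pearceyPhase σ y (I * u))‖ := by gcongr; exact hb u
    _ = M * (Real.exp (R * |u|) * ‖exp (-pearceyPhase σ y (I * u))‖) := by ring
    _ ≤ _ := by rw [mul_assoc]; gcongr

theorem abs_re_le_norm_I_mul_sub (t : ℂ) (u : ℝ) : |t.re| ≤ ‖I * (u : ℂ) - t‖ := by
  have := abs_re_le_norm (I * (u : ℂ) - t)
  simpa using this

theorem norm_inv_I_mul_sub_le_inv {t : ℂ} (ht : t.re ≠ 0) (u : ℝ) :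
    ‖(I * (u : ℂ) - t)⁻¹‖ ≤ |t.re|⁻¹ := by
  rw [norm_inv]
  exact inv_anti₀ (abs_pos.mpr ht) (abs_re_le_norm_I_mul_sub t u)

theorem I_mul_sub_ne_zero {t : ℂ} (ht : t.re ≠ 0) (u : ℝ) : I * (u : ℂ) - t ≠ 0 := by
  intro h
  have := congrArg re h
  simp at this
  exact ht this

theorem hasDerivAt_pearceyCauchy_aux (σ y : ℝ) {t : ℂ} (ht : t.re ≠ 0) :
    HasDerivAt (pearceyCauchy σ y)
      (∫ u : ℝ, exp (-pearceyPhase σ y (I * u)) * ((I * (u : ℂ) - t)⁻¹) ^ 2) t := by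
  have hpos : 0 < |t.re| := abs_pos.mpr ht
  have hP : Integrable fun u : ℝ => exp (-pearceyPhase σ y (I * u)) := by
    simpa using integrable_mul_exp_neg_pearceyPhase σ y (g := fun _ => 1) (M := 1) (R := 0)
      (by fun_prop) (by simp)
  have hball : ∀ z ∈ Metric.ball t (|t.re| / 2), |t.re| / 2 ≤ |z.re| := by
    intro z hz
    rw [Metric.mem_ball, dist_eq] at hz
    have h1 := (abs_re_le_norm (z - t)).trans hz.le
    rw [sub_re] at h1
    linarith [abs_sub_abs_le_abs_sub t.re z.re, abs_sub_comm t.re z.re]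
  refine (hasDerivAt_integral_of_dominated_loc_of_deriv_le (s := Metric.ball t (|t.re| / 2))
    (F := fun z (u : ℝ) => exp (-pearceyPhase σ y (I * u)) * (I * (u : ℂ) - z)⁻¹)
    (F' := fun z (u : ℝ) => exp (-pearceyPhase σ y (I * u)) * ((I * (u : ℂ) - z)⁻¹) ^ 2)
    (bound := fun u : ℝ => ‖exp (-pearceyPhase σ y (I * u))‖ * ((|t.re| / 2)⁻¹) ^ 2)
    (Metric.ball_mem_nhds _ (by positivity)) (.of_forall fun z => by fun_prop) ?_ (by fun_prop)
    (.of_forall fun u z hz => ?_) (hP.norm.mul_const _) (.of_forall fun u z hz => ?_)).2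
  · exact hP.mul_bdd (c := |t.re|⁻¹) (by fun_prop)
      (.of_forall fun u => norm_inv_I_mul_sub_le_inv ht u)
  · have hz' := hball z hz
    have hz0 : z.re ≠ 0 := abs_pos.mp (lt_of_lt_of_le (by positivity) hz')
    rw [norm_mul, norm_pow]
    gcongr
    exact (norm_inv_I_mul_sub_le_inv hz0 u).trans (inv_anti₀ (by positivity) hz')
  · have hz' := hball z hz
    have hz0 : z.re ≠ 0 := abs_pos.mp (lt_of_lt_of_le (by positivity) hz')
    refine ((((hasDerivAt_id z).const_sub (I * (u : ℂ))).fun_inv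
      (I_mul_sub_ne_zero hz0 u)).const_mul (exp (-pearceyPhase σ y (I * u)))).congr_deriv ?_
    simp [div_eq_mul_inv]

theorem integrable_pearceyPhaseDeriv_mul (σ y : ℝ) :
    Integrable fun u : ℝ => pearceyPhaseDeriv σ y (I * u) * exp (-pearceyPhase σ y (I * u)) := by
  refine integrable_mul_exp_neg_pearceyPhase σ y (M := 6 + |σ| + |y|) (R := 1) (by fun_prop)
    fun u => ?_
  have h1 := pow_le_factorial_mul_exp (abs_nonneg u) 1
  have h3 := pow_le_factorial_mul_exp (abs_nonneg u) 3
  have h0 := Real.one_le_exp (abs_nonneg u)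
  norm_num [Nat.factorial] at h1 h3
  unfold pearceyPhaseDeriv
  refine (norm_add_le _ _).trans ((add_le_add_left (norm_sub_le _ _) _).trans ?_)
  simp only [norm_pow, norm_mul, norm_I, norm_real, Real.norm_eq_abs, one_mul]
  nlinarith [mul_le_mul_of_nonneg_left h1 (abs_nonneg σ),
    mul_le_mul_of_nonneg_left h0 (abs_nonneg y)]

theorem hasDerivAt_pearceyCauchy (σ y : ℝ) {t : ℂ} (ht : t.re ≠ 0) :
    HasDerivAt (pearceyCauchy σ y) (∫ u : ℝ, -(pearceyPhaseDeriv σ y (I * u) *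
      exp (-pearceyPhase σ y (I * u)) * (I * (u : ℂ) - t)⁻¹)) t := by
  convert hasDerivAt_pearceyCauchy_aux σ y ht using 1
  have hP : Integrable fun u : ℝ => exp (-pearceyPhase σ y (I * u)) := by
    simpa using integrable_mul_exp_neg_pearceyPhase σ y (g := fun _ => 1) (M := 1) (R := 0)
      (by fun_prop) (by simp)
  have hinv := fun u : ℝ => norm_inv_I_mul_sub_le_inv ht u
  have hi0 : Integrable fun u : ℝ => exp (-pearceyPhase σ y (I * u)) * (I * (u : ℂ) - t)⁻¹ :=
    hP.mul_bdd (c := |t.re|⁻¹) (by fun_prop) (.of_forall hinv)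
  have hi1 : Integrable fun u : ℝ => pearceyPhaseDeriv σ y (I * u) *
      exp (-pearceyPhase σ y (I * u)) * (I * (u : ℂ) - t)⁻¹ :=
    (integrable_pearceyPhaseDeriv_mul σ y).mul_bdd (c := |t.re|⁻¹) (by fun_prop) (.of_forall hinv)
  have hi2 : Integrable fun u : ℝ => exp (-pearceyPhase σ y (I * u)) * ((I * (u : ℂ) - t)⁻¹) ^ 2 :=
    hP.mul_bdd (c := |t.re|⁻¹ ^ 2) (by fun_prop) (.of_forall fun u => by
      rw [norm_pow]; gcongr; exact hinv u)
  have key := integral_eq_zero_of_hasDerivAt_of_integrable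
    (f := fun u : ℝ => exp (-pearceyPhase σ y (I * u)) * (I * (u : ℂ) - t)⁻¹)
    (f' := fun u : ℝ => -I * (pearceyPhaseDeriv σ y (I * u) *
      exp (-pearceyPhase σ y (I * u)) * (I * (u : ℂ) - t)⁻¹ +
      exp (-pearceyPhase σ y (I * u)) * ((I * (u : ℂ) - t)⁻¹) ^ 2)) (fun u => ?_)
    ((hi1.add hi2).const_mul _) hi0
  · rw [integral_const_mul, integral_add hi1 hi2] at key
    rw [integral_neg]
    have := (mul_eq_zero.mp key).resolve_left (neg_ne_zero.mpr I_ne_zero)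
    linear_combination -this
  · have hl : HasDerivAt (fun u : ℝ => I * (u : ℂ)) I u := by
      simpa using (ofRealCLM.hasDerivAt (x := u)).const_mul I
    have h1 := ((hasDerivAt_pearceyPhase σ y (I * u)).comp u hl).fun_neg.cexp
    have h2 := (hl.sub_const t).fun_inv (I_mul_sub_ne_zero ht u)
    refine (h1.mul h2).congr_deriv ?_
    simp [div_eq_mul_inv]
    ring

theorem exists_norm_pearceyCauchy_le (σ y : ℝ) (hre : θ.re ^ 2 = 1 / 2) (him : θ.im ^ 2 = 1 / 2) :
    ∃ C : ℝ, ∀ r : ℝ, 0 < r → ‖pearceyCauchy σ y (r * θ)‖ ≤ C * r ^ (-(1 / 2) : ℝ) := by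
  obtain ⟨C, hC, h⟩ := exists_norm_exp_pearceyPhase_le σ y 0
  refine ⟨2 * C * ∫ u : ℝ, |u| ^ (-(1 / 2) : ℝ) * Real.exp (-u ^ 2), fun r hr => ?_⟩
  rw [mul_right_comm, ← integral_const_mul]
  refine norm_integral_le_of_norm_le (integrable_abs_rpow_mul_exp_neg_sq.const_mul _) ?_
  filter_upwards [Measure.ae_ne volume (0 : ℝ)] with u hu
  have k := h (-1) (I * u) u (by simp) (by simp) (by rw [mul_pow, I_pow_four]; ring)
  rw [neg_one_mul, zero_mul, Real.exp_zero, one_mul] at k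
  have k3 := norm_inv_I_mul_sub_le hre him hu hr.ne'
  rw [abs_of_pos hr] at k3
  rw [norm_mul]
  calc _ ≤ C * Real.exp (-u ^ 2) * (2 * (r ^ (-(1 / 2) : ℝ) * |u| ^ (-(1 / 2) : ℝ))) := by gcongr
    _ = _ := by ring

theorem norm_inv_sub_inv_le {θ' : ℂ} (hre : θ.re ^ 2 = 1 / 2) (him : θ.im ^ 2 = 1 / 2)
    (hre' : θ'.re = θ.re) (him' : θ'.im = -θ.im) (v : ℝ) :
    ‖(I * (v : ℂ) - θ)⁻¹ - (I * (v : ℂ) - θ')⁻¹‖ ≤ 8 * (1 + v ^ 2)⁻¹ := by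
  have hre2 : θ'.re ^ 2 = 1 / 2 := by rw [hre', hre]
  have him2 : θ'.im ^ 2 = 1 / 2 := by rw [him', neg_sq, him]
  have h0 : θ.re ≠ 0 := fun h => by simp [h] at hre
  have hX := I_mul_sub_ne_zero h0 v
  have hX' := I_mul_sub_ne_zero (hre'.trans_ne h0) v
  have h1 := sq_add_sq_le_norm_sq hre him v 1
  have h2 := sq_add_sq_le_norm_sq hre2 him2 v 1
  rw [ofReal_one, one_mul] at h1 h2
  have h3 : ‖θ - θ'‖ ≤ 2 := (norm_sub_le _ _).trans (by
    rw [norm_eq_one_of_re_im hre him, norm_eq_one_of_re_im hre2 him2]; norm_num)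
  have hmul : (1 + v ^ 2) / 4 ≤ ‖I * (v : ℂ) - θ‖ * ‖I * (v : ℂ) - θ'‖ := by
    refine (abs_le_of_sq_le_sq' ?_ (by positivity)).2
    rw [mul_pow, sq]
    refine mul_le_mul ?_ ?_ (by positivity) (by positivity) <;> linarith
  rw [inv_sub_inv hX hX', norm_div, norm_mul, sub_sub_sub_cancel_left]
  calc _ ≤ 2 / ((1 + v ^ 2) / 4) := by gcongr
    _ = _ := by field_simp; norm_num

theorem tendsto_log_sub_log {l : Filter ℝ} (hl : Tendsto (fun v : ℝ => v⁻¹) l (𝓝 0))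
    (hl0 : ∀ᶠ v in l, v ≠ 0) {a : ℝ} (ha : a ^ 2 = 1 / 2) :
    Tendsto (fun v : ℝ => Real.log (v ^ 2 + 2 * a * v + 1) - Real.log (v ^ 2 - 2 * a * v + 1)) l
      (𝓝 0) := by
  have h (c : ℝ) : Tendsto (fun v : ℝ => Real.log (1 + 2 * c * v⁻¹ + v⁻¹ ^ 2)) l (𝓝 0) := by
    have h1 : Tendsto (fun v : ℝ => 1 + 2 * c * v⁻¹ + v⁻¹ ^ 2) l (𝓝 1) := by
      simpa using ((hl.const_mul (2 * c)).const_add 1).add (hl.pow 2)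
    simpa using h1.log one_ne_zero
  have h2 := (h a).sub (h (-a))
  rw [sub_zero] at h2
  refine h2.congr' (hl0.mono fun v hv => ?_)
  have hpos (c : ℝ) (hc : c ^ 2 = 1 / 2) : 0 < v ^ 2 + 2 * c * v + 1 := by
    nlinarith [sq_nonneg (v + c)]
  have e (c : ℝ) : 1 + 2 * c * v⁻¹ + v⁻¹ ^ 2 = (v ^ 2 + 2 * c * v + 1) / v ^ 2 := by
    field_simp
  rw [e, e, Real.log_div (hpos a ha).ne' (by positivity),
    Real.log_div (hpos (-a) (by rw [neg_sq, ha])).ne' (by positivity)]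
  ring_nf

theorem integral_inv_sub_inv_eq_zero {θ' : ℂ} (hre : θ.re ^ 2 = 1 / 2) (him : θ.im ^ 2 = 1 / 2)
    (hre' : θ'.re = θ.re) (him' : θ'.im = -θ.im) :
    ∫ v : ℝ, ((I * (v : ℂ) - θ)⁻¹ - (I * (v : ℂ) - θ')⁻¹) = 0 := by
  have h0 : θ.re ≠ 0 := fun h => by simp [h] at hre
  set a := θ.re with ha
  set b := θ.im with hb
  have hθ : θ = a + b * I := (re_add_im θ).symm
  have hθ' : θ' = a - b * I := by
    rw [← re_add_im θ', hre', him']; push_cast; ring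
  have hac : (a : ℂ) ^ 2 = 1 / 2 := by rw [← ofReal_pow, hre]; norm_num
  have hbc : (b : ℂ) ^ 2 = 1 / 2 := by rw [← ofReal_pow, him]; norm_num
  have hfi : Integrable fun v : ℝ => (I * (v : ℂ) - θ)⁻¹ - (I * (v : ℂ) - θ')⁻¹ :=
    (integrable_inv_one_add_sq.const_mul 8).mono' (by fun_prop)
      (.of_forall fun v => norm_inv_sub_inv_le hre him hre' him' v)
  have hpos (c v : ℝ) (hc : c ^ 2 = 1 / 2) : 0 < v ^ 2 + 2 * c * v + 1 := by
    nlinarith [sq_nonneg (v + c)]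
  have hneg : (-a) ^ 2 = 1 / 2 := by rw [neg_sq, hre]
  let F : ℝ → ℂ := fun v => 2 * b * I *
    (((a / 2 * (Real.log (v ^ 2 + 2 * a * v + 1) - Real.log (v ^ 2 - 2 * a * v + 1)) : ℝ) : ℂ) +
      ((a * Real.arctan (v ^ 2) : ℝ) : ℂ) * I)
  have hlim {l : Filter ℝ} (hl : Tendsto (fun v : ℝ => v⁻¹) l (𝓝 0)) (hl0 : ∀ᶠ v in l, v ≠ 0)
      (hsq : Tendsto (fun v : ℝ => v ^ 2) l atTop) :
      Tendsto F l
        (𝓝 (2 * b * I * (((a / 2 * 0 : ℝ) : ℂ) + ((a * (Real.pi / 2) : ℝ) : ℂ) * I))) := by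
    have h1 := (tendsto_log_sub_log hl hl0 hre).const_mul (a / 2)
    have h2 := ((Real.tendsto_arctan_atTop.mono_right nhdsWithin_le_nhds).comp hsq).const_mul a
    exact ((((continuous_ofReal.tendsto _).comp h1).add
      (((continuous_ofReal.tendsto _).comp h2).mul_const I)).const_mul _)
  have hderiv (v : ℝ) : HasDerivAt F ((I * (v : ℂ) - θ)⁻¹ - (I * (v : ℂ) - θ')⁻¹) v := by
    have hp := hpos a v hre
    have hm : 0 < v ^ 2 - 2 * a * v + 1 := by linarith [hpos (-a) v hneg]
    have hN : (1 + v ^ 4 : ℝ) ≠ 0 := by positivity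
    have l1 : HasDerivAt (fun v : ℝ => v ^ 2 + 2 * a * v + 1) (2 * v + 2 * a) v := by
      simpa using (((hasDerivAt_pow 2 v).add ((hasDerivAt_id v).const_mul (2 * a))).add_const 1)
    have l2 : HasDerivAt (fun v : ℝ => v ^ 2 - 2 * a * v + 1) (2 * v - 2 * a) v := by
      simpa using (((hasDerivAt_pow 2 v).sub ((hasDerivAt_id v).const_mul (2 * a))).add_const 1)
    have d1 : HasDerivAt (fun v : ℝ => a / 2 *
        (Real.log (v ^ 2 + 2 * a * v + 1) - Real.log (v ^ 2 - 2 * a * v + 1)))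
        ((1 - v ^ 2) / (1 + v ^ 4)) v := by
      refine (((l1.log hp.ne').sub (l2.log hm.ne')).const_mul (a / 2)).congr_deriv ?_
      have hprod : 1 + v ^ 4 = (v ^ 2 + 2 * a * v + 1) * (v ^ 2 - 2 * a * v + 1) := by
        linear_combination 4 * v ^ 2 * hre
      rw [hprod, div_sub_div _ _ hp.ne' hm.ne', ← mul_div_assoc]
      congr 1
      linear_combination (2 - 2 * v ^ 2) * hre
    have d2 : HasDerivAt (fun v : ℝ => a * Real.arctan (v ^ 2)) (2 * a * v / (1 + v ^ 4)) v := by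
      refine ((hasDerivAt_pow 2 v).arctan.const_mul a).congr_deriv ?_
      rw [show (1 + (v ^ 2) ^ 2 : ℝ) = 1 + v ^ 4 by ring]
      push_cast
      field_simp
    refine ((d1.ofReal_comp.add (d2.ofReal_comp.mul_const I)).const_mul _).congr_deriv ?_
    have hX := I_mul_sub_ne_zero h0 v
    have hX' := I_mul_sub_ne_zero (hre'.trans_ne h0) v
    have hNc : (1 + (v : ℂ) ^ 4) ≠ 0 := by exact_mod_cast hN
    have hXX : (I * (v : ℂ) - θ) * (I * (v : ℂ) - θ') * ((1 - v ^ 2) + 2 * a * v * I) =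
        1 + v ^ 4 := by
      have : (I * (v : ℂ) - θ) * (I * (v : ℂ) - θ') = (1 - v ^ 2) - 2 * a * v * I := by
        rw [hθ, hθ']
        linear_combination hac + hbc + ((v : ℂ) ^ 2 - b ^ 2) * I_sq
      rw [this]
      linear_combination -4 * (a : ℂ) ^ 2 * v ^ 2 * I_sq + 4 * (v : ℂ) ^ 2 * hac
    rw [inv_sub_inv hX hX', eq_div_iff (mul_ne_zero hX hX'), sub_sub_sub_cancel_left]
    push_cast
    calc _ = 2 * b * I * ((I * (v : ℂ) - θ) * (I * (v : ℂ) - θ') *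
          ((1 - v ^ 2) + 2 * a * v * I)) / (1 + v ^ 4) := by ring
      _ = _ := by
        rw [hXX, mul_div_assoc, div_self hNc, hθ, hθ']
        ring
  have key := integral_of_hasDerivAt_of_tendsto hderiv hfi
    (hlim tendsto_inv_atBot_zero (eventually_ne_atBot 0) (by
      simpa [Function.comp_def] using
        (tendsto_pow_atTop (α := ℝ) two_ne_zero).comp tendsto_abs_atBot_atTop))
    (hlim tendsto_inv_atTop_zero (eventually_ne_atTop 0) (tendsto_pow_atTop two_ne_zero))
  rw [key, sub_self]

theorem tendsto_pearceyCauchy_sub {θ' : ℂ} (σ y : ℝ) (hre : θ.re ^ 2 = 1 / 2)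
    (him : θ.im ^ 2 = 1 / 2) (hre' : θ'.re = θ.re) (him' : θ'.im = -θ.im) :
    Tendsto (fun r : ℝ => pearceyCauchy σ y (r * θ) - pearceyCauchy σ y (r * θ'))
      (𝓝[>] 0) (𝓝 0) := by
  have h0 : θ.re ≠ 0 := fun h => by simp [h] at hre
  have hP : Integrable fun u : ℝ => exp (-pearceyPhase σ y (I * u)) := by
    simpa using integrable_mul_exp_neg_pearceyPhase σ y (g := fun _ => 1) (M := 1) (R := 0)
      (by fun_prop) (by simp)
  have hi {t : ℂ} (ht : t.re ≠ 0) :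
      Integrable fun u : ℝ => exp (-pearceyPhase σ y (I * u)) * (I * (u : ℂ) - t)⁻¹ :=
    hP.mul_bdd (c := |t.re|⁻¹) (by fun_prop) (.of_forall (norm_inv_I_mul_sub_le_inv ht))
  obtain ⟨C, hC, h⟩ := exists_norm_exp_pearceyPhase_le σ y 0
  have hbd (u : ℝ) : ‖exp (-pearceyPhase σ y (I * u))‖ ≤ C := by
    have k := h (-1) (I * u) u (by simp) (by simp) (by rw [mul_pow, I_pow_four]; ring)
    rw [neg_one_mul, zero_mul, Real.exp_zero, one_mul] at k
    exact k.trans (mul_le_of_le_one_right hC.le (Real.exp_le_one_iff.mpr (by nlinarith)))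
  have hscale : ∀ r : ℝ, 0 < r → pearceyCauchy σ y (r * θ) - pearceyCauchy σ y (r * θ') =
      ∫ v : ℝ, exp (-pearceyPhase σ y (I * (r * v : ℝ))) *
        ((I * (v : ℂ) - θ)⁻¹ - (I * (v : ℂ) - θ')⁻¹) := by
    intro r hr
    have hr1 : ((r : ℂ) * θ).re ≠ 0 := by simp [hr.ne', h0]
    have hr2 : ((r : ℂ) * θ').re ≠ 0 := by simp [hr.ne', hre', h0]
    unfold pearceyCauchy
    rw [← integral_sub (hi hr1) (hi hr2)]
    have := Measure.integral_comp_mul_left (fun u : ℝ => exp (-pearceyPhase σ y (I * u)) *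
      (I * (u : ℂ) - r * θ)⁻¹ - exp (-pearceyPhase σ y (I * u)) * (I * (u : ℂ) - r * θ')⁻¹) r
    rw [abs_of_pos (inv_pos.mpr hr), eq_inv_smul_iff₀ hr.ne', ← integral_smul] at this
    rw [← this]
    refine integral_congr_ae (.of_forall fun v => ?_)
    have hrc : (r : ℂ) ≠ 0 := by exact_mod_cast hr.ne'
    have e (z : ℂ) : (I * ((r * v : ℝ) : ℂ) - r * z)⁻¹ = (r : ℂ)⁻¹ * (I * (v : ℂ) - z)⁻¹ := by
      rw [← mul_inv]
      push_cast
      ring_nf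
    simp only [e, real_smul]
    field_simp
  refine Tendsto.congr' (f₁ := fun r : ℝ => ∫ v : ℝ, exp (-pearceyPhase σ y (I * (r * v : ℝ))) *
        ((I * (v : ℂ) - θ)⁻¹ - (I * (v : ℂ) - θ')⁻¹)) ?_ ?_
  · filter_upwards [self_mem_nhdsWithin] with r hr using (hscale r hr).symm
  rw [← integral_inv_sub_inv_eq_zero hre him hre' him']
  refine tendsto_integral_filter_of_dominated_convergence (fun v => C * (8 * (1 + v ^ 2)⁻¹))
    (.of_forall fun r => by fun_prop) (.of_forall fun r => .of_forall fun v => ?_)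
    ((integrable_inv_one_add_sq.const_mul 8).const_mul C) (.of_forall fun v => ?_)
  · rw [norm_mul]
    gcongr
    · exact hbd _
    · exact norm_inv_sub_inv_le hre him hre' him' v
  · have hc : Continuous fun r : ℝ => exp (-pearceyPhase σ y (I * (r * v : ℝ))) *
        ((I * (v : ℂ) - θ)⁻¹ - (I * (v : ℂ) - θ')⁻¹) := by fun_prop
    have := (hc.tendsto 0).mono_left (nhdsWithin_le_nhds (s := Set.Ioi 0))
    simpa [pearceyPhase] using this

theorem tendsto_exp_mul_pearceyCauchy_sub {θ' : ℂ} (τ σ x y : ℝ) (hre : θ.re ^ 2 = 1 / 2)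
    (him : θ.im ^ 2 = 1 / 2) (hre' : θ'.re = θ.re) (him' : θ'.im = -θ.im) :
    Tendsto (fun r : ℝ => exp (pearceyPhase τ x (r * θ)) * pearceyCauchy σ y (r * θ) -
      exp (pearceyPhase τ x (r * θ')) * pearceyCauchy σ y (r * θ')) (𝓝[>] 0) (𝓝 0) := by
  obtain ⟨C, hC⟩ := exists_norm_pearceyCauchy_le σ y hre him
  have hd (z : ℂ) : DifferentiableAt ℝ (fun r : ℝ => exp (pearceyPhase τ x (r * z))) 0 := by
    unfold pearceyPhase
    fun_prop
  have hO1 : (fun r : ℝ => exp (pearceyPhase τ x (r * θ)) - exp (pearceyPhase τ x (r * θ')))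
      =O[𝓝[>] 0] fun r : ℝ => r := by
    have := ((hd θ).sub (hd θ')).isBigO_sub.mono (nhdsWithin_le_nhds (s := Set.Ioi 0))
    simpa [pearceyPhase] using this
  have hO2 : (fun r : ℝ => pearceyCauchy σ y (r * θ)) =O[𝓝[>] 0] fun r : ℝ => r ^ (-(1 / 2) : ℝ) :=
    Asymptotics.IsBigO.of_bound C (by
      filter_upwards [self_mem_nhdsWithin] with r hr
      rw [Real.norm_of_nonneg (Real.rpow_nonneg (le_of_lt hr) _)]
      exact hC r hr)
  have hpow : Tendsto (fun r : ℝ => r * r ^ (-(1 / 2) : ℝ)) (𝓝[>] 0) (𝓝 0) := by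
    have h1 : Tendsto (fun r : ℝ => r ^ (1 / 2 : ℝ)) (𝓝[>] 0) (𝓝 0) := by
      have := (Real.continuousAt_rpow_const 0 (1 / 2) (Or.inr (by norm_num))).tendsto
      rw [Real.zero_rpow (by norm_num)] at this
      exact this.mono_left nhdsWithin_le_nhds
    refine h1.congr' ?_
    filter_upwards [self_mem_nhdsWithin] with r hr
    rw [← Real.rpow_one_add' (le_of_lt hr) (by norm_num)]
    norm_num
  have t1 := (hO1.mul hO2).trans_tendsto hpow
  have t2 : Tendsto (fun r : ℝ => exp (pearceyPhase τ x (r * θ'))) (𝓝[>] 0) (𝓝 1) := by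
    have := (hd θ').continuousAt.tendsto.mono_left (nhdsWithin_le_nhds (s := Set.Ioi 0))
    simpa [pearceyPhase] using this
  have t3 := t1.add (t2.mul (tendsto_pearceyCauchy_sub σ y hre him hre' him'))
  rw [mul_zero, add_zero] at t3
  refine t3.congr fun r => ?_
  ring

theorem hasDerivAt_exp_mul_pearceyCauchy (τ σ x y : ℝ) {r : ℝ} (hr : ((r : ℂ) * θ).re ≠ 0) :
    HasDerivAt (fun r : ℝ => exp (pearceyPhase τ x (r * θ)) * pearceyCauchy σ y (r * θ))
      (θ * ∫ u : ℝ, (pearceyPhaseDeriv τ x (r * θ) - pearceyPhaseDeriv σ y (I * u)) *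
        (exp (pearceyPhase τ x (r * θ)) * exp (-pearceyPhase σ y (I * u)) *
          (I * (u : ℂ) - r * θ)⁻¹)) r := by
  have hl : HasDerivAt (fun r : ℝ => (r : ℂ) * θ) θ r := by
    simpa using (ofRealCLM.hasDerivAt (x := r)).mul_const θ
  have hz := ((hasDerivAt_pearceyPhase τ x (r * θ)).cexp.mul
    (hasDerivAt_pearceyCauchy σ y hr)).comp r hl
  refine hz.congr_deriv ?_
  have hP : Integrable fun u : ℝ => exp (-pearceyPhase σ y (I * u)) := by
    simpa using integrable_mul_exp_neg_pearceyPhase σ y (g := fun _ => 1) (M := 1) (R := 0)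
      (by fun_prop) (by simp)
  have hinv := fun u : ℝ => norm_inv_I_mul_sub_le_inv hr u
  have hi0 : Integrable fun u : ℝ => exp (-pearceyPhase σ y (I * u)) * (I * (u : ℂ) - r * θ)⁻¹ :=
    hP.mul_bdd (c := |((r : ℂ) * θ).re|⁻¹) (by fun_prop) (.of_forall hinv)
  have hi1 : Integrable fun u : ℝ => -(pearceyPhaseDeriv σ y (I * u) *
      exp (-pearceyPhase σ y (I * u)) * (I * (u : ℂ) - r * θ)⁻¹) :=
    ((integrable_pearceyPhaseDeriv_mul σ y).mul_bdd (c := |((r : ℂ) * θ).re|⁻¹) (by fun_prop)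
      (.of_forall hinv)).neg
  rw [pearceyCauchy, mul_assoc (exp _), ← mul_add, ← integral_const_mul,
    ← integral_add (hi0.const_mul _) hi1, mul_comm _ θ, ← integral_const_mul]
  congr 1
  refine integral_congr_ae (.of_forall fun u => ?_)
  simp only
  ring

theorem integral_linear_combination_five {α : Type*} [MeasurableSpace α] {μ : Measure α}
    {f₁ f₂ f₃ f₄ f₅ : α → ℂ} (h₁ : Integrable f₁ μ) (h₂ : Integrable f₂ μ) (h₃ : Integrable f₃ μ)
    (h₄ : Integrable f₄ μ) (h₅ : Integrable f₅ μ) (a b c : ℂ) :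
    Integrable (fun p => f₁ p + f₂ p - a * f₃ p - b * f₄ p + c * f₅ p) μ ∧
    ∫ p, (f₁ p + f₂ p - a * f₃ p - b * f₄ p + c * f₅ p) ∂μ =
      ∫ p, f₁ p ∂μ + ∫ p, f₂ p ∂μ - a * ∫ p, f₃ p ∂μ - b * ∫ p, f₄ p ∂μ + c * ∫ p, f₅ p ∂μ := by
  have e₂ : Integrable (fun p => f₁ p + f₂ p) μ := h₁.add h₂
  have e₃ : Integrable (fun p => f₁ p + f₂ p - a * f₃ p) μ := e₂.sub (h₃.const_mul a)
  have e₄ : Integrable (fun p => f₁ p + f₂ p - a * f₃ p - b * f₄ p) μ := e₃.sub (h₄.const_mul b)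
  refine ⟨e₄.add (h₅.const_mul c), ?_⟩
  rw [integral_add e₄ (h₅.const_mul c), integral_sub e₃ (h₄.const_mul b),
    integral_sub e₂ (h₃.const_mul a), integral_add h₁ h₂, integral_const_mul, integral_const_mul,
    integral_const_mul]

/-- The Pearcey operator applied to the double integral over one ray. -/
noncomputable def pearceyOperatorMoment (θ : ℂ) (τ σ x y : ℝ) : ℂ :=
  pearceyMoment θ τ σ 3 0 x y + pearceyMoment θ τ σ 0 3 x y - τ * pearceyMoment θ τ σ 1 0 x y -
    σ * pearceyMoment θ τ σ 0 1 x y + (x - y) * pearceyMoment θ τ σ 0 0 x y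

theorem integral_pearceyPhaseDeriv_sub (hre : θ.re ^ 2 = 1 / 2) (him : θ.im ^ 2 = 1 / 2)
    (τ σ x y : ℝ) :
    Integrable (fun p : ℝ × ℝ =>
      (pearceyPhaseDeriv τ x (p.1 * θ) - pearceyPhaseDeriv σ y (I * p.2)) *
      (exp (pearceyPhase τ x (p.1 * θ)) * exp (-pearceyPhase σ y (I * p.2)) *
        (I * (p.2 : ℂ) - p.1 * θ)⁻¹)) ((volume.restrict (Set.Ioi 0)).prod volume) ∧
    ∫ p : ℝ × ℝ, (pearceyPhaseDeriv τ x (p.1 * θ) - pearceyPhaseDeriv σ y (I * p.2)) *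
      (exp (pearceyPhase τ x (p.1 * θ)) * exp (-pearceyPhase σ y (I * p.2)) *
        (I * (p.2 : ℂ) - p.1 * θ)⁻¹) ∂((volume.restrict (Set.Ioi 0)).prod volume) =
      pearceyOperatorMoment θ τ σ x y := by
  have h (n m : ℕ) := integrable_pearceyMoment hre him τ σ n m x y
  obtain ⟨h1, h2⟩ := integral_linear_combination_five (h 3 0) (h 0 3) (h 1 0) (h 0 1) (h 0 0) τ σ
    ((x : ℂ) - y)
  refine ⟨h1.congr (.of_forall fun p => ?_),
    (integral_congr_ae (.of_forall fun p => ?_)).trans h2⟩ <;>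
  · simp only [pearceyPhaseDeriv]
    ring

theorem integrableOn_exp_mul_pearceyCauchy (hre : θ.re ^ 2 = 1 / 2) (him : θ.im ^ 2 = 1 / 2)
    (τ σ x y : ℝ) :
    IntegrableOn (fun r : ℝ => exp (pearceyPhase τ x (r * θ)) * pearceyCauchy σ y (r * θ))
      (Set.Ioi 0) ∧
    ∫ r in Set.Ioi (0 : ℝ), exp (pearceyPhase τ x (r * θ)) * pearceyCauchy σ y (r * θ) =
      pearceyMoment θ τ σ 0 0 x y := by
  have h := integrable_pearceyMoment hre him τ σ 0 0 x y
  have e (r : ℝ) : ∫ u : ℝ, (r * θ) ^ 0 * (-(I * u)) ^ 0 *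
      (exp (pearceyPhase τ x (r * θ)) * exp (-pearceyPhase σ y (I * u)) *
        (I * (u : ℂ) - r * θ)⁻¹) =
      exp (pearceyPhase τ x (r * θ)) * pearceyCauchy σ y (r * θ) := by
    rw [pearceyCauchy, ← integral_const_mul]
    simp [mul_assoc]
  refine ⟨h.integral_prod_left.congr (.of_forall e), ?_⟩
  rw [pearceyMoment, integral_prod _ h]
  exact integral_congr_ae (.of_forall fun r => (e r).symm)

/-- The boundary contributions at the origin of two rays in the same half plane agree. -/
theorem mul_pearceyOperatorMoment_eq {θ' : ℂ} (hre : θ.re ^ 2 = 1 / 2)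
    (him : θ.im ^ 2 = 1 / 2) (hre' : θ'.re = θ.re) (him' : θ'.im = -θ.im) (τ σ x y : ℝ) :
    θ * pearceyOperatorMoment θ τ σ x y = θ' * pearceyOperatorMoment θ' τ σ x y := by
  have hre2 : θ'.re ^ 2 = 1 / 2 := by rw [hre', hre]
  have him2 : θ'.im ^ 2 = 1 / 2 := by rw [him', neg_sq, him]
  have h0 : θ.re ≠ 0 := fun h => by simp [h] at hre
  obtain ⟨hi, he⟩ := integral_pearceyPhaseDeriv_sub hre him τ σ x y
  obtain ⟨hi', he'⟩ := integral_pearceyPhaseDeriv_sub hre2 him2 τ σ x y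
  have hd (r : ℝ) (hr : r ∈ Set.Ioi (0 : ℝ)) :=
    (hasDerivAt_exp_mul_pearceyCauchy (θ := θ) τ σ x y (r := r)
      (by simp [(Set.mem_Ioi.mp hr).ne', h0])).sub
    (hasDerivAt_exp_mul_pearceyCauchy (θ := θ') τ σ x y (r := r)
      (by simp [(Set.mem_Ioi.mp hr).ne', hre', h0]))
  have hD' := (hi.integral_prod_left.const_mul θ).sub (hi'.integral_prod_left.const_mul θ')
  have hD := (integrableOn_exp_mul_pearceyCauchy hre him τ σ x y).1.sub
    (integrableOn_exp_mul_pearceyCauchy hre2 him2 τ σ x y).1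
  have htop := tendsto_zero_of_hasDerivAt_of_integrableOn_Ioi hd hD' hD
  have key := integral_Ioi_of_hasDerivAt_of_tendsto (a := 0) (m := 0)
    (f := Function.update (fun r : ℝ =>
      exp (pearceyPhase τ x (r * θ)) * pearceyCauchy σ y (r * θ) -
      exp (pearceyPhase τ x (r * θ')) * pearceyCauchy σ y (r * θ')) 0 0) ?_
    (fun r hr => (hd r hr).congr_of_eventuallyEq ?_) hD' (htop.congr' ?_)
  · rw [Function.update_self, sub_zero] at key
    have e := integral_sub (hi.integral_prod_left.const_mul θ) (hi'.integral_prod_left.const_mul θ')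
    rw [integral_const_mul, integral_const_mul, ← integral_prod _ hi, ← integral_prod _ hi', he,
      he'] at e
    exact sub_eq_zero.mp (e.symm.trans key)
  · rw [continuousWithinAt_update_same, Set.Ici_sdiff_left]
    exact tendsto_exp_mul_pearceyCauchy_sub τ σ x y hre him hre' him'
  · filter_upwards [eventually_ne_nhds (Set.mem_Ioi.mp hr).ne'] with z hz
    simp [Function.update_of_ne hz]
  · filter_upwards [eventually_ne_atTop 0] with z hz
    simp [Function.update_of_ne hz]

theorem exp_pi_div_four_mul_I :
    exp ((Real.pi / 4 : ℝ) * I) = ⟨√2 / 2, √2 / 2⟩ := by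
  apply Complex.ext
  · rw [exp_ofReal_mul_I_re, Real.cos_pi_div_four]
  · rw [exp_ofReal_mul_I_im, Real.sin_pi_div_four]

theorem exp_neg_pi_div_four_mul_I :
    exp (-((Real.pi / 4 : ℝ) * I)) = ⟨√2 / 2, -(√2 / 2)⟩ := by
  rw [← neg_mul, ← ofReal_neg]
  apply Complex.ext
  · rw [exp_ofReal_mul_I_re, Real.cos_neg, Real.cos_pi_div_four]
  · rw [exp_ofReal_mul_I_im, Real.sin_neg, Real.sin_pi_div_four]

/-- Second commutator relation for the extended Pearcey kernel:
`(∂_x³ + ∂_y³ − τ_i ∂_x − τ_j ∂_y + (x − y)) H(x,y) = 0`, where `H` is the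
`(i,j)` entry of the extended Pearcey kernel, with the `s`-integral along the
imaginary axis (`s = iu`) and the `t`-contour the four Pearcey rays. -/
theorem extended_pearcey_second_commutator
    (τi τj : ℝ)
    (E : ℝ → ℝ → ℂ → ℂ → ℂ)
    (hE : ∀ x y s t, E x y s t =
      Complex.exp (-s^4 / 4 + (τj : ℂ) * s^2 / 2 - (y : ℂ) * s
        + t^4 / 4 - (τi : ℂ) * t^2 / 2 + (x : ℂ) * t))
    (S : ℝ → ℝ → ℂ → ℂ)
    (hS : ∀ x y t, S x y t =
      ∫ u : ℝ, Complex.I * E x y (Complex.I * (u : ℂ)) t / (Complex.I * (u : ℂ) - t))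
    (ω ω' : ℂ)
    (hω : ω = Complex.exp ((Real.pi / 4 : ℝ) * Complex.I))
    (hω' : ω' = Complex.exp (-((Real.pi / 4 : ℝ) * Complex.I)))
    (H : ℝ → ℝ → ℂ)
    (hH : ∀ x y, H x y = -(1 / (4 * Real.pi^2)) *
      ∫ r in Set.Ioi (0:ℝ),
        (ω' * S x y ((r : ℂ) * ω') - ω' * S x y (-((r : ℂ) * ω'))
          - ω * S x y ((r : ℂ) * ω) + ω * S x y (-((r : ℂ) * ω)))) :
    ∀ x y : ℝ,
      iteratedDeriv 3 (fun u => H u y) x + iteratedDeriv 3 (fun v => H x v) y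
        - (τi : ℂ) * deriv (fun u => H u y) x - (τj : ℂ) * deriv (fun v => H x v) y
        + ((x : ℂ) - (y : ℂ)) * H x y = 0 := by
  have hE' (x y : ℝ) (s t : ℂ) :
      E x y s t = exp (pearceyPhase τi x t) * exp (-pearceyPhase τj y s) := by
    rw [hE, ← exp_add]
    unfold pearceyPhase
    ring_nf
  have hS' (x y : ℝ) (t : ℂ) :
      S x y t = I * (exp (pearceyPhase τi x t) * pearceyCauchy τj y t) := by
    rw [hS, pearceyCauchy, ← integral_const_mul, ← integral_const_mul]
    refine integral_congr_ae (.of_forall fun u => ?_)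
    simp only [hE', div_eq_mul_inv]
    ring
  have hsq : (√2 / 2) ^ 2 = (1 / 2 : ℝ) := by
    rw [div_pow, Real.sq_sqrt zero_le_two]
    norm_num
  have hre : ω.re ^ 2 = 1 / 2 := by rw [hω, exp_pi_div_four_mul_I]; exact hsq
  have him : ω.im ^ 2 = 1 / 2 := by rw [hω, exp_pi_div_four_mul_I]; exact hsq
  have hre' : ω'.re = ω.re := by
    rw [hω, hω', exp_pi_div_four_mul_I, exp_neg_pi_div_four_mul_I]
  have him' : ω'.im = -ω.im := by
    rw [hω, hω', exp_pi_div_four_mul_I, exp_neg_pi_div_four_mul_I]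
  have hre2 : ω'.re ^ 2 = 1 / 2 := by rw [hre', hre]
  have him2 : ω'.im ^ 2 = 1 / 2 := by rw [him', neg_sq, him]
  have hren : (-ω).re ^ 2 = 1 / 2 := by rw [neg_re, neg_sq, hre]
  have himn : (-ω).im ^ 2 = 1 / 2 := by rw [neg_im, neg_sq, him]
  have hre2n : (-ω').re ^ 2 = 1 / 2 := by rw [neg_re, neg_sq, hre2]
  have him2n : (-ω').im ^ 2 = 1 / 2 := by rw [neg_im, neg_sq, him2]
  let K (n m : ℕ) (x y : ℝ) : ℂ := -(1 / (4 * Real.pi ^ 2)) * (I *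
    (ω' * pearceyMoment ω' τi τj n m x y - ω' * pearceyMoment (-ω') τi τj n m x y
      - ω * pearceyMoment ω τi τj n m x y + ω * pearceyMoment (-ω) τi τj n m x y))
  have hHK (x y : ℝ) : H x y = K 0 0 x y := by
    obtain ⟨i₁, e₁⟩ := integrableOn_exp_mul_pearceyCauchy hre2 him2 τi τj x y
    obtain ⟨i₂, e₂⟩ := integrableOn_exp_mul_pearceyCauchy hre2n him2n τi τj x y
    obtain ⟨i₃, e₃⟩ := integrableOn_exp_mul_pearceyCauchy hre him τi τj x y
    obtain ⟨i₄, e₄⟩ := integrableOn_exp_mul_pearceyCauchy hren himn τi τj x y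
    have h := (integral_linear_combination_five (integrable_zero _ _ _)
      (i₁.const_mul (I * ω')) i₂ i₃ i₄ (I * ω') (I * ω) (I * ω)).2
    rw [integral_const_mul, e₁, e₂, e₃, e₄] at h
    simp only [Pi.zero_apply, integral_zero, zero_add] at h
    rw [hH]
    simp only [K]
    congr 1
    refine Eq.trans (integral_congr_ae (.of_forall fun r => ?_)) (h.trans (by ring))
    simp only [hS', mul_neg]
    ring
  have hx (n m : ℕ) (x y : ℝ) : HasDerivAt (fun u => K n m u y) (K (n + 1) m x y) x := by
    have h {θ : ℂ} (h1 : θ.re ^ 2 = 1 / 2) (h2 : θ.im ^ 2 = 1 / 2) :=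
      hasDerivAt_pearceyMoment_left h1 h2 τi τj n m x y
    exact ((((((h hre2 him2).const_mul ω').sub ((h hre2n him2n).const_mul ω')).sub
      ((h hre him).const_mul ω)).add ((h hren himn).const_mul ω)).const_mul I).const_mul _
  have hy (n m : ℕ) (x y : ℝ) : HasDerivAt (fun v => K n m x v) (K n (m + 1) x y) y := by
    have h {θ : ℂ} (h1 : θ.re ^ 2 = 1 / 2) (h2 : θ.im ^ 2 = 1 / 2) :=
      hasDerivAt_pearceyMoment_right h1 h2 τi τj n m x y
    exact ((((((h hre2 him2).const_mul ω').sub ((h hre2n him2n).const_mul ω')).sub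
      ((h hre him).const_mul ω)).add ((h hren himn).const_mul ω)).const_mul I).const_mul _
  intro x y
  simp only [hHK]
  have hx3 := iteratedDeriv_eq_of_hasDerivAt (g := fun n u => K n 0 u y) (fun n u => hx n 0 u y) 3
  have hy3 := iteratedDeriv_eq_of_hasDerivAt (g := fun m v => K 0 m x v) (fun m v => hy 0 m x v) 3
  rw [hx3, hy3, (hx 0 0 x y).deriv, (hy 0 0 x y).deriv]
  have p₁ := mul_pearceyOperatorMoment_eq hre him hre' him' τi τj x y
  have p₂ := mul_pearceyOperatorMoment_eq hren himn (θ' := -ω') (by simp [hre']) (by simp [him'])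
    τi τj x y
  simp only [pearceyOperatorMoment] at p₁ p₂
  simp only [K, zero_add]
  linear_combination (1 / (4 * Real.pi ^ 2 : ℂ)) * I * p₁ + (1 / (4 * Real.pi ^ 2 : ℂ)) * I * p₂
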